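/- Let f ∈ C²(I) on an open interval I. Then f is n-matrix convex if and only if for every choice of λ₁,…,λₙ ∈ I, each Kraus matrix H(p) = 2([λₚ,λᵢ,λⱼ]_f)ᵢⱼ, p = 1,…,n, is positive semidefinite. -/

import Mathlib

open Matrix Set
open scoped ComplexOrder

noncomputable section

/-- `f` is `n`-matrix monotone on `I`. -/
def MatMonoOn (n : ℕ) (I : Set ℝ) (f : ℝ → ℝ) : Prop :=
  ∀ (A B : Matrix (Fin n) (Fin n) ℂ) (hA : A.IsHermitian) (hB : B.IsHermitian),
    (∀ i, hA.eigenvalues i ∈ I) → (∀ i, hB.eigenvalues i ∈ I) →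
    (B - A).PosSemidef → (hB.cfc f - hA.cfc f).PosSemidef

/-- `f` is `n`-matrix concave on `I`. -/
def MatConcaveOn (n : ℕ) (I : Set ℝ) (f : ℝ → ℝ) : Prop :=
  ∀ (A B : Matrix (Fin n) (Fin n) ℂ) (hA : A.IsHermitian) (hB : B.IsHermitian)
    (s : ℝ), s ∈ Icc (0:ℝ) 1 →
    (∀ i, hA.eigenvalues i ∈ I) → (∀ i, hB.eigenvalues i ∈ I) →
    ∀ (hC : ((s:ℂ) • A + ((1:ℂ) - (s:ℂ)) • B).IsHermitian),
      (hC.cfc f - ((s:ℂ) • hA.cfc f + ((1:ℂ) - (s:ℂ)) • hB.cfc f)).PosSemidef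

/-- `f` is `n`-matrix convex on `I`. -/
def MatConvexOn (n : ℕ) (I : Set ℝ) (f : ℝ → ℝ) : Prop :=
  ∀ (A B : Matrix (Fin n) (Fin n) ℂ) (hA : A.IsHermitian) (hB : B.IsHermitian)
    (s : ℝ), s ∈ Icc (0:ℝ) 1 →
    (∀ i, hA.eigenvalues i ∈ I) → (∀ i, hB.eigenvalues i ∈ I) →
    ∀ (hC : ((s:ℂ) • A + ((1:ℂ) - (s:ℂ)) • B).IsHermitian),
      (((s:ℂ) • hA.cfc f + ((1:ℂ) - (s:ℂ)) • hB.cfc f) - hC.cfc f).PosSemidef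

/-- First divided difference. -/
def dd (f : ℝ → ℝ) (t s : ℝ) : ℝ :=
  if t = s then deriv f t else (f t - f s) / (t - s)

/-- Second divided difference. -/
def dd2 (f : ℝ → ℝ) (t s r : ℝ) : ℝ :=
  if t = s then
    (if s = r then deriv (deriv f) t / 2 else (deriv f t - dd f t r) / (t - r))
  else if t = r then (deriv f t - dd f t s) / (t - s)
  else (dd f t s - dd f s r) / (t - r)


open Filter Topology

section DividedDifferences

variable {f : ℝ → ℝ} {I : Set ℝ}

lemma dd_comm (f : ℝ → ℝ) (t s : ℝ) : dd f t s = dd f s t := by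
  unfold dd
  split_ifs with h h' h'
  · rw [h]
  · exact absurd h.symm h'
  · exact absurd h'.symm h
  · rw [← neg_div_neg_eq, neg_sub, neg_sub]

lemma sub_mul_dd (f : ℝ → ℝ) (t s : ℝ) : (s - t) * dd f t s = f s - f t := by
  unfold dd
  split_ifs with h
  · simp [h]
  · have := sub_ne_zero.2 h
    field_simp
    ring

lemma sub_mul_dd2 (f : ℝ → ℝ) (t s r : ℝ) :
    (r - t) * dd2 f t s r = dd f s r - dd f s t := by
  by_cases hr : t = r
  · simp [hr]
  have hr' := sub_ne_zero.2 hr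
  unfold dd2
  split_ifs with h h'
  · exact absurd (h.trans h') hr
  · subst h
    rw [show dd f t t = deriv f t by simp [dd]]
    field_simp
    ring
  · rw [dd_comm f s t]
    field_simp
    ring

lemma dd_eq_dslope (f : ℝ → ℝ) (t : ℝ) : dd f t = dslope f t := by
  ext s
  by_cases h : s = t
  · simp [h, dd]
  · rw [dslope_of_ne _ h, dd_comm, dd, if_neg h, slope_def_field]

lemma continuousOn_dd (hI : IsOpen I) (hf : DifferentiableOn ℝ f I) {t : ℝ} (ht : t ∈ I) :
    ContinuousOn (dd f t) I := by
  rw [dd_eq_dslope, continuousOn_dslope (hI.mem_nhds ht)]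
  exact ⟨hf.continuousOn, hf.differentiableAt (hI.mem_nhds ht)⟩

lemma dd2_of_ne (f : ℝ → ℝ) {t s : ℝ} (h : t ≠ s) (r : ℝ) :
    dd2 f t s r = (dd f t r - dd f s r) / (t - s) := by
  have hts := sub_ne_zero.2 h
  unfold dd2
  rw [if_neg h]
  split_ifs with hr
  · subst hr
    rw [show dd f t t = deriv f t by simp [dd], dd_comm]
  · have htr := sub_ne_zero.2 hr
    have h1 := sub_mul_dd f t s
    have h2 := sub_mul_dd f t r
    have h3 := sub_mul_dd f s r
    rw [div_eq_div_iff htr hts]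
    linear_combination h2 - h1 - h3

lemma continuousOn_dd2 (hI : IsOpen I) (hI' : I.OrdConnected) (hf : ContDiffOn ℝ 2 f I) {t s : ℝ}
    (ht : t ∈ I) (hs : s ∈ I) : ContinuousOn (dd2 f t s) I := by
  have hd : DifferentiableOn ℝ f I := hf.differentiableOn (by norm_num)
  by_cases h : t = s
  · subst h
    have hcont : ∀ r, dd2 f t t r =
        if t = r then deriv (deriv f) t / 2 else (deriv f t - dd f t r) / (t - r) := by
      intro r
      simp [dd2]
    intro r hr
    refine ContinuousAt.continuousWithinAt ?_
    by_cases htr : t = r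
    · subst htr
      have key := taylor_tendsto hI'.convex ht (n := 2) (by exact_mod_cast hf)
      rw [hI.nhdsWithin_eq ht] at key
      have h1 : derivWithin f I t = deriv f t := derivWithin_of_isOpen hI ht
      have h2 : iteratedDerivWithin 2 f I t = deriv (deriv f) t := by
        rw [iteratedDerivWithin_of_isOpen hI ht, iteratedDeriv_succ, iteratedDeriv_one]
      have key' := (key.mono_left (nhdsWithin_le_nhds (s := {t}ᶜ))).add_const
        (deriv (deriv f) t / 2)
      rw [← continuousWithinAt_compl_self, ContinuousWithinAt]
      refine (key'.congr' ?_).trans (by simp [hcont])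
      filter_upwards [self_mem_nhdsWithin] with x hx
      have hx' : x - t ≠ 0 := sub_ne_zero.2 hx
      have hx'' : t - x ≠ 0 := sub_ne_zero.2 (Ne.symm hx)
      rw [hcont, if_neg (Ne.symm hx)]
      have hdd : dd f t x = (f x - f t) / (x - t) := by
        rw [eq_div_iff hx', mul_comm, sub_mul_dd]
      simp only [taylorWithinEval_succ, taylor_within_zero_eval, h2, smul_eq_mul, hdd,
        iteratedDerivWithin_one, h1, zero_add]
      rw [show t - x = -(x - t) by ring]
      norm_num
      field_simp
      ring
    · have : ContinuousAt (fun r => (deriv f t - dd f t r) / (t - r)) r :=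
        (continuousAt_const.sub ((continuousOn_dd hI hd ht).continuousAt (hI.mem_nhds hr))).div
          (by fun_prop) (sub_ne_zero.2 htr)
      refine this.congr ?_
      filter_upwards [isOpen_ne.mem_nhds (Ne.symm htr)] with x hx
      rw [hcont, if_neg (Ne.symm hx)]
  · rw [show dd2 f t s = fun r => (dd f t r - dd f s r) / (t - s) from funext (dd2_of_ne f h)]
    exact ((continuousOn_dd hI hd ht).sub (continuousOn_dd hI hd hs)).div_const _

end DividedDifferences

section MatrixFunctions

open scoped Matrix.Norms.L2Operator

variable {ι : Type*} [Fintype ι] [DecidableEq ι] {f : ℝ → ℝ} {I : Set ℝ}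

lemma continuousOn_spectrum_matrix (f : ℝ → ℝ) (A : Matrix ι ι ℂ) :
    ContinuousOn f (spectrum ℝ A) :=
  A.finite_real_spectrum.continuousOn f

lemma cfc_diagonal_add_apply {g : ℝ → ℝ} (l : ι → ℝ) (D : Matrix ι ι ℂ)
    (hA : IsSelfAdjoint (diagonal (fun i => (l i : ℂ)) + D)) (i j : ι)
    (hg : ∀ μ, (μ - l i) * g μ = f μ - f (l i)) :
    cfc f (diagonal (fun i => (l i : ℂ)) + D) i j = (if i = j then (f (l i) : ℂ) else 0) +
      ∑ k, D i k * cfc g (diagonal (fun i => (l i : ℂ)) + D) k j := by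
  set A := diagonal (fun i => (l i : ℂ)) + D with hAdef
  have hc := continuousOn_spectrum_matrix (A := A)
  have h1 : cfc f A = algebraMap ℝ (Matrix ι ι ℂ) (f (l i)) +
      (A - algebraMap ℝ (Matrix ι ι ℂ) (l i)) * cfc g A := by
    have hid : A - algebraMap ℝ (Matrix ι ι ℂ) (l i) = cfc (fun μ => μ - l i) A := by
      rw [cfc_sub _ _ A (hc _) (hc _), cfc_const _ A, cfc_id' ℝ A]
    rw [hid, ← cfc_mul _ _ A (hc _) (hc _), ← cfc_const (f (l i)) A,
      ← cfc_add A _ _ (hc _) (hc _)]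
    congr 1
    ext μ
    rw [hg]
    ring
  rw [h1, Matrix.add_apply, Matrix.mul_apply]
  refine congrArg₂ _ ?_ ?_
  · simp [Matrix.algebraMap_matrix_apply]
  · refine Finset.sum_congr rfl fun k _ => ?_
    congr 1
    rw [hAdef]
    by_cases hik : i = k
    · subst hik
      simp [Matrix.algebraMap_matrix_apply]
    · simp [Matrix.algebraMap_matrix_apply, hik]

lemma cfc_diagonal_add_apply_second_order (f : ℝ → ℝ) (l : ι → ℝ) (D : Matrix ι ι ℂ)
    (hA : IsSelfAdjoint (diagonal (fun i => (l i : ℂ)) + D)) (i j : ι) :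
    cfc f (diagonal (fun i => (l i : ℂ)) + D) i j =
      (if i = j then (f (l i) : ℂ) else 0) + D i j * dd f (l i) (l j) +
      ∑ k, D i k * ∑ m, D k m *
        cfc (dd2 f (l k) (l i)) (diagonal (fun i => (l i : ℂ)) + D) m j := by
  rw [cfc_diagonal_add_apply l D hA i j (sub_mul_dd f (l i)), add_assoc]
  congr 1
  have : ∀ k, cfc (dd f (l i)) (diagonal (fun i => (l i : ℂ)) + D) k j = _ := fun k =>
    cfc_diagonal_add_apply l D hA k j (sub_mul_dd2 f (l k) (l i))
  simp_rw [this, mul_add, Finset.sum_add_distrib]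
  simp

lemma exists_isCompact_eventually_spectrum_subset (hI : IsOpen I) {A : Matrix ι ι ℂ}
    (hA : spectrum ℝ A ⊆ I) :
    ∃ S, IsCompact S ∧ S ⊆ I ∧ ∀ᶠ B in 𝓝 A, spectrum ℝ B ⊆ S := by
  obtain ⟨S, hS, hAS, hSI⟩ := exists_compact_between A.finite_real_spectrum.isCompact hI hA
  refine ⟨S, hS, hSI, ?_⟩
  filter_upwards [(upperHemicontinuous_spectrum ℝ (Matrix ι ι ℂ)).upperHemicontinuousAt A S
    (subset_interior_iff_mem_nhdsSet.1 hAS)] with B hB using subset_of_mem_nhdsSet hB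

lemma tendsto_cfc_matrix (hI : IsOpen I) (hf : ContinuousOn f I) {X : Type*} {F : Filter X}
    {a : X → Matrix ι ι ℂ} {A : Matrix ι ι ℂ} (ha : Tendsto a F (𝓝 A)) (hA : spectrum ℝ A ⊆ I)
    (hsa : IsSelfAdjoint A) (hsa' : ∀ x, IsSelfAdjoint (a x)) :
    Tendsto (fun x => cfc f (a x)) F (𝓝 (cfc f A)) := by
  obtain ⟨S, hS, hSI, hev⟩ := exists_isCompact_eventually_spectrum_subset hI hA
  exact ha.cfc hS f (ha.eventually hev) (.of_forall hsa') hev.self_of_nhds hsa (hf.mono hSI)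

/-- The second derivative of `h ↦ f (diagonal l + h D)` at `0`. -/
def secondVariation (f : ℝ → ℝ) (l : ι → ℝ) (D : Matrix ι ι ℂ) : Matrix ι ι ℂ :=
  Matrix.of fun i j => ∑ k, D i k * D k j * ((2 * dd2 f (l k) (l i) (l j) : ℝ) : ℂ)

/-- The normalized symmetric second difference of `h ↦ f (A + h D)` at `0`. -/
def secondDifference (f : ℝ → ℝ) (A D : Matrix ι ι ℂ) (h : ℝ) : Matrix ι ι ℂ :=
  ((h ^ 2)⁻¹ : ℝ) • (cfc f (A + h • D) + cfc f (A + (-h) • D) - (2 : ℝ) • cfc f A)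

lemma spectrum_real_diagonal (l : ι → ℝ) :
    spectrum ℝ (diagonal (fun i => (l i : ℂ))) = range l := by
  ext x
  simp [spectrum.mem_iff, Matrix.algebraMap_eq_diagonal, Matrix.isUnit_iff_isUnit_det,
    Finset.prod_eq_zero_iff, sub_eq_zero, eq_comm (a := x)]

lemma isSelfAdjoint_diagonal_ofReal (l : ι → ℝ) :
    IsSelfAdjoint (diagonal (fun i => (l i : ℂ))) := by
  rw [← Matrix.isHermitian_iff_isSelfAdjoint]
  exact Matrix.isHermitian_diagonal_of_self_adjoint _ (by ext; simp)

lemma cfc_diagonal_ofReal (f : ℝ → ℝ) (l : ι → ℝ) :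
    cfc f (diagonal (fun i => (l i : ℂ))) = diagonal (fun i => (f (l i) : ℂ)) := by
  ext i j
  have := cfc_diagonal_add_apply_second_order f l 0
    (by simpa using isSelfAdjoint_diagonal_ofReal l) i j
  simpa [diagonal_apply] using this

lemma tendsto_secondDifference_diagonal (hI : IsOpen I) (hI' : I.OrdConnected)
    (hf : ContDiffOn ℝ 2 f I) {l : ι → ℝ} (hl : ∀ i, l i ∈ I) {D : Matrix ι ι ℂ}
    (hD : IsSelfAdjoint D) :
    Tendsto (secondDifference f (diagonal (fun i => (l i : ℂ))) D) (𝓝[≠] 0)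
      (𝓝 (secondVariation f l D)) := by
  set L := diagonal (fun i => (l i : ℂ)) with hL
  have hLsa : IsSelfAdjoint L := isSelfAdjoint_diagonal_ofReal l
  have hsa : ∀ h : ℝ, IsSelfAdjoint (L + h • D) := fun h =>
    hLsa.add (IsSelfAdjoint.smul (star_trivial h) hD)
  refine tendsto_pi_nhds.2 fun i => tendsto_pi_nhds.2 fun j => ?_
  have hlim : ∀ k, Tendsto (fun h : ℝ => cfc (dd2 f (l k) (l i)) (L + h • D)) (𝓝[≠] 0)
      (𝓝 (diagonal (fun m => (dd2 f (l k) (l i) (l m) : ℂ)))) := by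
    intro k
    rw [← cfc_diagonal_ofReal]
    refine tendsto_cfc_matrix hI (continuousOn_dd2 hI hI' hf (hl k) (hl i)) ?_
      (by rw [spectrum_real_diagonal]; rintro _ ⟨m, rfl⟩; exact hl m) hLsa hsa
    have : Continuous fun h : ℝ => L + h • D := by fun_prop
    simpa using (this.tendsto 0).mono_left nhdsWithin_le_nhds
  have hneg : Tendsto (fun h : ℝ => -h) (𝓝[≠] 0) (𝓝[≠] 0) := by
    refine tendsto_nhdsWithin_iff.2 ⟨?_, ?_⟩
    · simpa using (continuous_neg.tendsto (0 : ℝ)).mono_left nhdsWithin_le_nhds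
    · filter_upwards [self_mem_nhdsWithin] with h hh using neg_ne_zero.2 hh
  have hentry : ∀ k m, Tendsto
      (fun h : ℝ => cfc (dd2 f (l k) (l i)) (L + h • D) m j
        + cfc (dd2 f (l k) (l i)) (L + (-h) • D) m j) (𝓝[≠] 0)
      (𝓝 (if m = j then ((2 * dd2 f (l k) (l i) (l m) : ℝ) : ℂ) else 0)) := by
    intro k m
    have h1 := tendsto_pi_nhds.1 (tendsto_pi_nhds.1 (hlim k) m) j
    have hlim_eq : (if m = j then ((2 * dd2 f (l k) (l i) (l m) : ℝ) : ℂ) else 0) =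
        diagonal (fun m => (dd2 f (l k) (l i) (l m) : ℂ)) m j +
        diagonal (fun m => (dd2 f (l k) (l i) (l m) : ℂ)) m j := by
      rw [diagonal_apply]
      split_ifs <;> push_cast <;> ring
    rw [hlim_eq]
    exact h1.add (h1.comp hneg)
  have hsum : Tendsto (fun h : ℝ => ∑ k, D i k * ∑ m, D k m *
      (cfc (dd2 f (l k) (l i)) (L + h • D) m j + cfc (dd2 f (l k) (l i)) (L + (-h) • D) m j))
      (𝓝[≠] 0) (𝓝 (secondVariation f l D i j)) := by
    have : secondVariation f l D i j = ∑ k, D i k * ∑ m, D k m *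
        (if m = j then ((2 * dd2 f (l k) (l i) (l m) : ℝ) : ℂ) else 0) := by
      simp [secondVariation, mul_assoc]
    rw [this]
    exact tendsto_finsetSum _ fun k _ => (tendsto_finsetSum _ fun m _ =>
      (hentry k m).const_mul _).const_mul _
  refine hsum.congr' ?_
  filter_upwards [self_mem_nhdsWithin] with h hh
  have hh' : (h : ℂ) ≠ 0 := by exact_mod_cast hh
  have e1 := cfc_diagonal_add_apply_second_order f l (h • D) (hsa h) i j
  have e2 := cfc_diagonal_add_apply_second_order f l ((-h) • D) (hsa (-h)) i j
  have e0 := congrFun (congrFun (cfc_diagonal_ofReal f l) i) j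
  simp only [secondDifference, Matrix.smul_apply, Matrix.add_apply, Matrix.sub_apply]
  rw [e0, e1, e2]
  simp only [Matrix.smul_apply, Complex.real_smul, diagonal_apply, mul_add,
    Finset.sum_add_distrib, Finset.mul_sum, ← hL]
  push_cast
  have c1 : ∀ (F : ι → ι → ℂ), ∑ k, ∑ m, (h * D i k) * ((h * D k m) * F k m)
      = (h : ℂ) ^ 2 * ∑ k, ∑ m, D i k * (D k m * F k m) := by
    intro F
    simp only [Finset.mul_sum]
    exact Finset.sum_congr rfl fun k _ => Finset.sum_congr rfl fun m _ => by ring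
  have c2 : ∀ (F : ι → ι → ℂ), ∑ k, ∑ m, (-h * D i k) * ((-h * D k m) * F k m)
      = (h : ℂ) ^ 2 * ∑ k, ∑ m, D i k * (D k m * F k m) := by
    intro F
    simp only [Finset.mul_sum]
    exact Finset.sum_congr rfl fun k _ => Finset.sum_congr rfl fun m _ => by ring
  rw [c1, c2]
  field_simp
  ring

end MatrixFunctions

lemma dd2_comm_right (f : ℝ → ℝ) (t s r : ℝ) : dd2 f t s r = dd2 f t r s := by
  by_cases hs : t = s
  · by_cases hr : t = r
    · rw [← hs, ← hr]
    · subst hs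
      simp [dd2, hr]
  · by_cases hr : t = r
    · subst hr
      simp [dd2, hs]
    · rw [dd2_of_ne f hs, dd2, if_neg hr, if_neg hs, dd_comm f s r]

lemma le_chord_of_secondDifference_tendsto {φ : ℝ → ℝ} (hφ : ContinuousOn φ (Icc 0 1))
    (h2 : ∀ t ∈ Ioo (0 : ℝ) 1, ∃ q, 0 ≤ q ∧
      Tendsto (fun h => (h ^ 2)⁻¹ * (φ (t + h) + φ (t + -h) - 2 * φ t)) (𝓝[≠] 0) (𝓝 q))
    {s : ℝ} (hs : s ∈ Icc (0 : ℝ) 1) : φ s ≤ s * φ 1 + (1 - s) * φ 0 := by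
  by_contra! hlt
  set ε := φ s - (s * φ 1 + (1 - s) * φ 0) with hε
  have hεpos : 0 < ε := by linarith
  set χ : ℝ → ℝ := fun t => φ t - (t * φ 1 + (1 - t) * φ 0) - ε * (t * (1 - t)) with hχ
  have hχc : ContinuousOn χ (Icc 0 1) := by
    refine (hφ.sub ?_).sub ?_ <;> fun_prop
  obtain ⟨t, ht, hmax⟩ := isCompact_Icc.exists_isMaxOn ⟨s, hs⟩ hχc
  have hχs : 0 < χ s := by
    have : s * (1 - s) ≤ 1 / 4 := by nlinarith [sq_nonneg (s - 1 / 2)]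
    simp only [hχ, ← hε]
    nlinarith
  have hχt : 0 < χ t := hχs.trans_le (hmax hs)
  have ht0 : t ≠ 0 := by
    rintro rfl
    simp [hχ] at hχt
  have ht1 : t ≠ 1 := by
    rintro rfl
    simp [hχ] at hχt
  have htI : t ∈ Ioo (0 : ℝ) 1 := ⟨ht.1.lt_of_ne' ht0, ht.2.lt_of_ne ht1⟩
  obtain ⟨q, hq, hlim⟩ := h2 t htI
  have hev : ∀ᶠ h in 𝓝[≠] (0 : ℝ),
      (h ^ 2)⁻¹ * (φ (t + h) + φ (t + -h) - 2 * φ t) ≤ -2 * ε := by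
    have h1 : ∀ᶠ h in 𝓝[≠] (0 : ℝ), t + h ∈ Ioo (0 : ℝ) 1 :=
      nhdsWithin_le_nhds <| ContinuousAt.eventually_mem (f := fun h => t + h) (by fun_prop)
        (by simpa using isOpen_Ioo.mem_nhds htI)
    have h2 : ∀ᶠ h in 𝓝[≠] (0 : ℝ), t + -h ∈ Ioo (0 : ℝ) 1 :=
      nhdsWithin_le_nhds <| ContinuousAt.eventually_mem (f := fun h => t + -h) (by fun_prop)
        (by simpa using isOpen_Ioo.mem_nhds htI)
    filter_upwards [h1, h2, self_mem_nhdsWithin] with h h1 h2 hh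
    have m1 : χ (t + h) ≤ χ t := hmax (Ioo_subset_Icc_self h1)
    have m2 : χ (t + -h) ≤ χ t := hmax (Ioo_subset_Icc_self h2)
    have hpos : 0 < h ^ 2 := by have : h ≠ 0 := hh; positivity
    rw [inv_mul_le_iff₀ hpos]
    simp only [hχ] at m1 m2
    nlinarith
  linarith [le_of_tendsto hlim hev]

section PositiveSemidefinite

open scoped Matrix.Norms.L2Operator

variable {ι : Type*} [Fintype ι] [DecidableEq ι] {f : ℝ → ℝ} {I : Set ℝ}

open scoped MatrixOrder in
lemma posSemidef_map_ofReal {M : Matrix ι ι ℝ} (hM : M.PosSemidef) :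
    (M.map (fun a => (a : ℂ))).PosSemidef := by
  obtain ⟨B, rfl⟩ := CStarAlgebra.nonneg_iff_eq_star_mul_self.mp hM.nonneg
  have : (star B * B).map (fun a => (a : ℂ)) =
      (B.map (fun a => (a : ℂ)))ᴴ * B.map (fun a => (a : ℂ)) := by
    ext i j
    simp [Matrix.mul_apply, Matrix.star_apply]
  rw [this]
  exact Matrix.posSemidef_conjTranspose_mul_self _

lemma posSemidef_secondVariation {l : ι → ℝ}
    (hH : ∀ p, (Matrix.of fun i j => 2 * dd2 f (l p) (l i) (l j)).PosSemidef)
    {D : Matrix ι ι ℂ} (hD : IsSelfAdjoint D) : (secondVariation f l D).PosSemidef := by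
  have hD' : ∀ i j, star (D j i) = D i j := fun i j => congrFun (congrFun hD i) j
  have : secondVariation f l D = ∑ k, (vecMulVec (star (D k)) (D k)) ⊙
      (Matrix.of fun i j => 2 * dd2 f (l k) (l i) (l j)).map (fun a => (a : ℂ)) := by
    ext i j
    rw [Matrix.sum_apply]
    simp only [secondVariation, Matrix.of_apply, hadamard_apply, vecMulVec_apply, Pi.star_apply,
      hD', Matrix.map_apply]
  rw [this]
  exact Matrix.posSemidef_sum _ fun k _ =>
    (Matrix.posSemidef_vecMulVec_star_self _).hadamard (posSemidef_map_ofReal (hH k))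

lemma map_secondDifference (φ : Matrix ι ι ℂ ≃⋆ₐ[ℂ] Matrix ι ι ℂ) (hφ : Continuous φ)
    (f : ℝ → ℝ) {A D : Matrix ι ι ℂ} (hA : IsSelfAdjoint A) (hD : IsSelfAdjoint D) (h : ℝ) :
    φ (secondDifference f A D h) = secondDifference f (φ A) (φ D) h := by
  have hsm : ∀ (r : ℝ) (M : Matrix ι ι ℂ), φ (r • M) = r • φ M := fun r M => by
    rw [← Complex.coe_smul, map_smul, Complex.coe_smul]
  have hsa : ∀ r : ℝ, IsSelfAdjoint (A + r • D) := fun r =>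
    hA.add (IsSelfAdjoint.smul (star_trivial r) hD)
  have hcfc : ∀ M : Matrix ι ι ℂ, IsSelfAdjoint M → φ (cfc f M) = cfc f (φ M) := fun M hM =>
    StarAlgHomClass.map_cfc (R := ℝ) (S := ℂ) φ f M (continuousOn_spectrum_matrix f M) hφ hM
      (hM.map φ)
  simp only [secondDifference, hsm, map_sub, map_add, hcfc _ (hsa _), hcfc _ hA]

lemma continuous_conjStarAlgAut (U : unitary (Matrix ι ι ℂ)) :
    Continuous (Unitary.conjStarAlgAut ℂ (Matrix ι ι ℂ) U) := by
  have : Continuous fun M : Matrix ι ι ℂ => (U : Matrix ι ι ℂ) * M * star (U : Matrix ι ι ℂ) := by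
    fun_prop
  exact this.congr fun M => (Unitary.conjStarAlgAut_apply U M).symm

lemma exists_tendsto_secondDifference (hI : IsOpen I) (hI' : I.OrdConnected)
    (hf : ContDiffOn ℝ 2 f I)
    (hH : ∀ l : ι → ℝ, (∀ i, l i ∈ I) → ∀ p,
      (Matrix.of fun i j => 2 * dd2 f (l p) (l i) (l j)).PosSemidef)
    {A D : Matrix ι ι ℂ} (hA : IsSelfAdjoint A) (hAI : spectrum ℝ A ⊆ I) (hD : IsSelfAdjoint D) :
    ∃ Q : Matrix ι ι ℂ, Q.PosSemidef ∧ Tendsto (secondDifference f A D) (𝓝[≠] 0) (𝓝 Q) := by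
  have hA' : A.IsHermitian := hA
  have hlI : ∀ i, hA'.eigenvalues i ∈ I := fun i => hAI (hA'.eigenvalues_mem_spectrum_real i)
  obtain ⟨φ, hφ⟩ : ∃ φ, φ = Unitary.conjStarAlgAut ℂ (Matrix ι ι ℂ) hA'.eigenvectorUnitary :=
    ⟨_, rfl⟩
  have hdiag : φ (diagonal (fun i => (hA'.eigenvalues i : ℂ))) = A := by
    rw [hφ]
    exact hA'.spectral_theorem.symm
  have hcont : Continuous φ := hφ ▸ continuous_conjStarAlgAut _
  have hD' : IsSelfAdjoint (φ.symm D) := hD.map φ.symm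
  have hQ := posSemidef_secondVariation (hH hA'.eigenvalues hlI) hD'
  refine ⟨φ (secondVariation f hA'.eigenvalues (φ.symm D)), ?_, ?_⟩
  · rw [hφ, Unitary.conjStarAlgAut_apply, ← hφ]
    exact hQ.mul_mul_conjTranspose_same _
  · have hlim := (hcont.tendsto _).comp (tendsto_secondDifference_diagonal hI hI' hf hlI hD')
    refine hlim.congr fun h => ?_
    rw [Function.comp_apply, map_secondDifference φ hcont f (isSelfAdjoint_diagonal_ofReal _) hD',
      hdiag, StarAlgEquiv.apply_symm_apply]

open scoped MatrixOrder in
lemma spectrum_add_smul_sub_subset (hI' : I.OrdConnected) {A B : Matrix ι ι ℂ}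
    (hA : IsSelfAdjoint A) (hB : IsSelfAdjoint B) (hAI : spectrum ℝ A ⊆ I)
    (hBI : spectrum ℝ B ⊆ I) {t : ℝ} (ht : t ∈ Icc (0 : ℝ) 1) :
    spectrum ℝ (B + t • (A - B)) ⊆ I := by
  intro x hx
  have hfin : (spectrum ℝ A ∪ spectrum ℝ B).Finite :=
    A.finite_real_spectrum.union B.finite_real_spectrum
  have hne : (spectrum ℝ A ∪ spectrum ℝ B).Nonempty := by
    rcases isEmpty_or_nonempty ι with _ | ⟨⟨i⟩⟩
    · simp [spectrum.of_subsingleton] at hx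
    · exact ⟨_, .inl (Matrix.IsHermitian.eigenvalues_mem_spectrum_real hA i)⟩
  obtain ⟨a, ha, hmin⟩ := hfin.isCompact.exists_isLeast hne
  obtain ⟨b, hb, hmax⟩ := hfin.isCompact.exists_isGreatest hne
  have hC : IsSelfAdjoint (B + t • (A - B)) :=
    hB.add (IsSelfAdjoint.smul (star_trivial t) (hA.sub hB))
  have hT : spectrum ℝ A ∪ spectrum ℝ B ⊆ I := union_subset hAI hBI
  have hcomb : B + t • (A - B) = t • A + (1 - t) • B := by module
  have hle : ∀ {X Y Z W : Matrix ι ι ℂ}, X ≤ Y → Z ≤ W →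
      t • X + (1 - t) • Z ≤ t • Y + (1 - t) • W := by
    intro X Y Z W h1 h2
    rw [Matrix.le_iff] at h1 h2 ⊢
    have h3 := (h1.smul ht.1).add (h2.smul (sub_nonneg.2 ht.2))
    convert h3 using 1
    module
  refine hI'.out (hT ha) (hT hb) ⟨?_, ?_⟩
  · refine (algebraMap_le_iff_le_spectrum (a := B + t • (A - B)) hC).1 ?_ x hx
    have h1 := (algebraMap_le_iff_le_spectrum (a := A) hA).2 fun y hy => hmin (.inl hy)
    have h2 := (algebraMap_le_iff_le_spectrum (a := B) hB).2 fun y hy => hmin (.inr hy)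
    rw [hcomb]
    convert hle h1 h2 using 1
    module
  · refine (le_algebraMap_iff_spectrum_le (a := B + t • (A - B)) hC).1 ?_ x hx
    have h1 := (le_algebraMap_iff_spectrum_le (a := A) hA).2 fun y hy => hmax (.inl hy)
    have h2 := (le_algebraMap_iff_spectrum_le (a := B) hB).2 fun y hy => hmax (.inr hy)
    rw [hcomb]
    convert hle h1 h2 using 1
    module

end PositiveSemidefinite

section MatrixConvexity

open scoped Matrix.Norms.L2Operator

lemma matConvexOn_iff {n : ℕ} {I : Set ℝ} {f : ℝ → ℝ} :
    MatConvexOn n I f ↔ ∀ A B : Matrix (Fin n) (Fin n) ℂ, IsSelfAdjoint A → IsSelfAdjoint B →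
      spectrum ℝ A ⊆ I → spectrum ℝ B ⊆ I → ∀ s ∈ Icc (0 : ℝ) 1,
      (s • cfc f A + (1 - s) • cfc f B - cfc f (B + s • (A - B))).PosSemidef := by
  have hcomb : ∀ (A B : Matrix (Fin n) (Fin n) ℂ) (s : ℝ),
      (s : ℂ) • A + ((1 : ℂ) - (s : ℂ)) • B = B + s • (A - B) := by
    intro A B s
    rw [← Complex.coe_smul]
    module
  have hsm : ∀ (B : Matrix (Fin n) (Fin n) ℂ) (s : ℝ),
      ((1 : ℂ) - (s : ℂ)) • B = (1 - s) • B := by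
    intro B s
    rw [← Complex.coe_smul]
    push_cast
    rfl
  have hspec : ∀ {A : Matrix (Fin n) (Fin n) ℂ} (hA : A.IsHermitian),
      spectrum ℝ A ⊆ I ↔ ∀ i, hA.eigenvalues i ∈ I := by
    intro A hA
    rw [hA.spectrum_real_eq_range_eigenvalues, range_subset_iff]
  constructor
  · intro h A B hA hB hAI hBI s hs
    have hC : ((s : ℂ) • A + ((1 : ℂ) - (s : ℂ)) • B).IsHermitian := by
      rw [hcomb]
      exact hB.add (IsSelfAdjoint.smul (star_trivial s) (hA.sub hB))
    have := h A B hA hB s hs ((hspec hA).1 hAI) ((hspec hB).1 hBI) hC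
    rwa [← hC.cfc_eq, ← Matrix.IsHermitian.cfc_eq hA, ← Matrix.IsHermitian.cfc_eq hB, hcomb A B,
      hsm, Complex.coe_smul] at this
  · intro h A B hA hB s hs hAI hBI hC
    rw [← hC.cfc_eq, ← hA.cfc_eq, ← hB.cfc_eq, hcomb A B, hsm, Complex.coe_smul]
    exact h A B hA hB ((hspec hA).2 hAI) ((hspec hB).2 hBI) s hs

variable {n : ℕ} {I : Set ℝ} {f : ℝ → ℝ}

lemma matConvexOn_of_kraus (hI : IsOpen I) (hI' : I.OrdConnected) (hf : ContDiffOn ℝ 2 f I)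
    (hH : ∀ l : Fin n → ℝ, (∀ i, l i ∈ I) → ∀ p : Fin n,
      (Matrix.of fun i j => 2 * dd2 f (l p) (l i) (l j)).PosSemidef) :
    MatConvexOn n I f := by
  refine matConvexOn_iff.2 fun A B hA hB hAI hBI s hs => ?_
  have hD : IsSelfAdjoint (A - B) := hA.sub hB
  have hsa : ∀ t : ℝ, IsSelfAdjoint (B + t • (A - B)) := fun t =>
    hB.add (IsSelfAdjoint.smul (star_trivial t) hD)
  have hspec : ∀ t ∈ Icc (0 : ℝ) 1, spectrum ℝ (B + t • (A - B)) ⊆ I := fun t ht =>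
    spectrum_add_smul_sub_subset hI' hA hB hAI hBI ht
  have hherm : (s • cfc f A + (1 - s) • cfc f B - cfc f (B + s • (A - B))).IsHermitian :=
    ((IsSelfAdjoint.smul (star_trivial s) (cfc_predicate f A)).add
      (IsSelfAdjoint.smul (star_trivial (1 - s)) (cfc_predicate f B))).sub (cfc_predicate f _)
  refine .of_dotProduct_mulVec_nonneg hherm fun x => ?_
  let ψ : Matrix (Fin n) (Fin n) ℂ →ₗ[ℝ] ℝ :=
    { toFun := fun M => (star x ⬝ᵥ (M *ᵥ x)).re
      map_add' := fun M N => by simp [add_mulVec, dotProduct_add]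
      map_smul' := fun r M => by simp [smul_mulVec, dotProduct_smul] }
  have hψ : Continuous ψ := ψ.continuous_of_finiteDimensional
  have hchord := le_chord_of_secondDifference_tendsto
    (φ := fun t => ψ (cfc f (B + t • (A - B)))) ?_ ?_ hs
  · rw [RCLike.nonneg_iff]
    refine ⟨?_, hherm.im_star_dotProduct_mulVec_self x⟩
    change 0 ≤ ψ _
    simp only [one_smul, zero_smul, add_zero, add_sub_cancel] at hchord
    rw [map_sub, map_add, map_smul, map_smul, smul_eq_mul, smul_eq_mul]
    linarith
  · intro t ht
    refine (hψ.tendsto _).comp (tendsto_cfc_matrix hI hf.continuousOn ?_ (hspec t ht) (hsa t) hsa)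
    have : Continuous fun t : ℝ => B + t • (A - B) := by fun_prop
    exact (this.tendsto t).mono_left nhdsWithin_le_nhds
  · intro t ht
    obtain ⟨Q, hQ, hlim⟩ := exists_tendsto_secondDifference hI hI' hf hH (hsa t)
      (hspec t (Ioo_subset_Icc_self ht)) hD
    refine ⟨ψ Q, (RCLike.nonneg_iff.1 (hQ.dotProduct_mulVec_nonneg x)).1,
      ((hψ.tendsto Q).comp hlim).congr fun h => ?_⟩
    have hadd : ∀ r : ℝ, B + t • (A - B) + r • (A - B) = B + (t + r) • (A - B) := by
      intro r
      module
    simp only [Function.comp_apply, secondDifference, hadd, map_smul, map_sub, map_add,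
      smul_eq_mul]

lemma MatConvexOn.secondVariation_nonneg (h : MatConvexOn n I f) (hI : IsOpen I)
    (hI' : I.OrdConnected) (hf : ContDiffOn ℝ 2 f I) {l : Fin n → ℝ} (hl : ∀ i, l i ∈ I)
    {D : Matrix (Fin n) (Fin n) ℂ} (hD : IsSelfAdjoint D) (x : Fin n → ℂ) :
    0 ≤ star x ⬝ᵥ (secondVariation f l D *ᵥ x) := by
  have hL := isSelfAdjoint_diagonal_ofReal l
  have hLI : spectrum ℝ (diagonal (fun i => (l i : ℂ))) ⊆ I := by
    rw [spectrum_real_diagonal]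
    rintro _ ⟨i, rfl⟩
    exact hl i
  obtain ⟨S, -, hSI, hS⟩ := exists_isCompact_eventually_spectrum_subset hI hLI
  have hcont : Continuous fun M : Matrix (Fin n) (Fin n) ℂ => star x ⬝ᵥ (M *ᵥ x) := by fun_prop
  refine ge_of_tendsto ((hcont.tendsto _).comp
    (tendsto_secondDifference_diagonal hI hI' hf hl hD)) ?_
  set L := diagonal (fun i => (l i : ℂ))
  have hsa : ∀ r : ℝ, IsSelfAdjoint (L + r • D) := fun r =>
    hL.add (IsSelfAdjoint.smul (star_trivial r) hD)
  have h1 : ∀ᶠ r : ℝ in 𝓝[≠] 0, spectrum ℝ (L + r • D) ⊆ S := by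
    have : Continuous fun r : ℝ => L + r • D := by fun_prop
    exact ((this.tendsto' 0 L (by simp)).mono_left nhdsWithin_le_nhds).eventually hS
  have h2 : ∀ᶠ r : ℝ in 𝓝[≠] 0, spectrum ℝ (L + (-r) • D) ⊆ S := by
    have : Continuous fun r : ℝ => L + (-r) • D := by fun_prop
    exact ((this.tendsto' 0 L (by simp)).mono_left nhdsWithin_le_nhds).eventually hS
  filter_upwards [h1, h2] with r h1 h2
  have hmid := matConvexOn_iff.1 h _ _ (hsa r) (hsa (-r)) (h1.trans hSI) (h2.trans hSI) (1 / 2)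
    ⟨by norm_num, by norm_num⟩
  have hL' : L + (-r) • D + (1 / 2 : ℝ) • (L + r • D - (L + (-r) • D)) = L := by module
  rw [hL'] at hmid
  have hsd : secondDifference f L D r = (2 * (r ^ 2)⁻¹ : ℝ) •
      ((1 / 2 : ℝ) • cfc f (L + r • D) + (1 - 1 / 2 : ℝ) • cfc f (L + (-r) • D) - cfc f L) := by
    rw [secondDifference]
    module
  rw [Function.comp_apply, hsd]
  exact (hmid.smul (by positivity)).dotProduct_mulVec_nonneg x

lemma star_dotProduct_secondVariation_mulVec (f : ℝ → ℝ) (l c : Fin n → ℝ)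
    {d : Fin n → Fin n → ℝ} (hd : ∀ i j, d i j = d j i) :
    star (fun i => (c i : ℂ)) ⬝ᵥ (secondVariation f l (Matrix.of fun i j => (d i j : ℂ)) *ᵥ
      fun i => (c i : ℂ)) =
    ((∑ k, ∑ i, ∑ j, (d k i * c i) * (2 * dd2 f (l k) (l i) (l j)) * (d k j * c j) : ℝ) : ℂ) := by
  simp only [dotProduct, mulVec, secondVariation, Matrix.of_apply, Pi.star_apply, RCLike.star_def,
    Complex.conj_ofReal, Finset.sum_mul, Finset.mul_sum]
  push_cast
  rw [Finset.sum_comm_cycle]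
  refine Finset.sum_congr rfl fun k _ => Finset.sum_congr rfl fun i _ =>
    Finset.sum_congr rfl fun j _ => ?_
  rw [hd i k]
  ring

lemma MatConvexOn.kraus_quadraticForm_nonneg (h : MatConvexOn n I f) (hI : IsOpen I)
    (hI' : I.OrdConnected) (hf : ContDiffOn ℝ 2 f I) {l : Fin n → ℝ} (hl : ∀ i, l i ∈ I)
    (p : Fin n) (v : Fin n → ℝ) :
    0 ≤ ∑ i, ∑ j, v i * (2 * dd2 f (l p) (l i) (l j)) * v j := by
  set b := ∑ k ∈ Finset.univ.erase p, v k ^ 2 * (2 * dd2 f (l k) (l p) (l p)) with hb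
  have key : ∀ ε : ℝ, ε ≠ 0 →
      0 ≤ (∑ i, ∑ j, v i * (2 * dd2 f (l p) (l i) (l j)) * v j) + ε ^ 2 * b := by
    intro ε hε
    let d : Fin n → Fin n → ℝ := fun i j =>
      if i = p then (if j = p then v p / ε else v j) else if j = p then v i else 0
    let c : Fin n → ℝ := fun i => if i = p then ε else 1
    have hd : ∀ i j, d i j = d j i := by
      intro i j
      simp only [d]
      split_ifs <;> rfl
    have hdp : ∀ j, d p j * c j = v j := by
      intro j
      by_cases hj : j = p
      · subst hj
        simp [d, c, hε]
      · simp [d, c, hj]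
    have hdk : ∀ k, k ≠ p → ∀ j, d k j * c j = if j = p then v k * ε else 0 := by
      intro k hk j
      by_cases hj : j = p <;> simp [d, c, hj, hk]
    have hD : IsSelfAdjoint (Matrix.of fun i j => (d i j : ℂ)) := by
      ext i j
      simp [Matrix.star_apply, hd j i]
    have hnn := h.secondVariation_nonneg hI hI' hf hl hD fun i => (c i : ℂ)
    rw [star_dotProduct_secondVariation_mulVec f l c hd, Complex.zero_le_real,
      ← Finset.add_sum_erase _ _ (Finset.mem_univ p)] at hnn
    simp only [hdp] at hnn
    refine hnn.trans_eq (congrArg₂ _ rfl ?_)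
    rw [hb, Finset.mul_sum]
    refine Finset.sum_congr rfl fun k hk => ?_
    simp only [hdk k (Finset.ne_of_mem_erase hk)]
    simp
    ring
  have hlim : Tendsto (fun ε : ℝ =>
      (∑ i, ∑ j, v i * (2 * dd2 f (l p) (l i) (l j)) * v j) + ε ^ 2 * b) (𝓝[≠] 0)
      (𝓝 (∑ i, ∑ j, v i * (2 * dd2 f (l p) (l i) (l j)) * v j)) :=
    (Continuous.tendsto' (by fun_prop) 0 _ (by simp)).mono_left nhdsWithin_le_nhds
  refine ge_of_tendsto hlim ?_
  filter_upwards [self_mem_nhdsWithin] with ε hε using key ε hε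

end MatrixConvexity

theorem stmt7 (n : ℕ) (I : Set ℝ) (hI : IsOpen I) (hI' : I.OrdConnected)
    (f : ℝ → ℝ) (hf : ContDiffOn ℝ 2 f I) :
    MatConvexOn n I f ↔ ∀ l : Fin n → ℝ, (∀ i, l i ∈ I) → ∀ p : Fin n,
      (Matrix.of fun i j => 2 * dd2 f (l p) (l i) (l j)).PosSemidef := by
  refine ⟨fun h l hl p => .of_dotProduct_mulVec_nonneg ?_ fun v => ?_,
    matConvexOn_of_kraus hI hI' hf⟩
  · ext i j
    simp [dd2_comm_right f (l p) (l j)]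
  · refine (h.kraus_quadraticForm_nonneg hI hI' hf hl p v).trans_eq ?_
    simp only [dotProduct, mulVec, Matrix.of_apply, Pi.star_apply, star_trivial, Finset.mul_sum,
      mul_assoc]

end
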